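/- arXiv:0907.2748 — 2 statements merged into one kernel-verified Lean document; each statement's English description precedes it below -/
import Mathlib

section
/- For every integer n ≥ 1 and every x > 0, the Gaussian tail integral satisfies the upper bound ∫_x^∞ exp(-t²/2) dt ≤ (h_n(x)/g_n(x)) exp(-x²/2). -/
open Nat Finset MeasureTheory Real

noncomputable def gp (n : ℕ) (x : ℝ) : ℝ :=
  ∑ i ∈ Finset.range (n+1), ((2*n+1)! : ℝ) / ((2*(n-i))‼ * (2*i+1)!) * x^(2*i+1)

noncomputable def hp (n : ℕ) (x : ℝ) : ℝ :=
  ∑ i ∈ Finset.range (n+1), ((n+i)! * (n-i)! : ℝ) / ((2*(n-i))‼ * (2*i)!) *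
    (∑ j ∈ Finset.range (n-i+1), ((2*n+1).choose j : ℝ)) * x^(2*i)

noncomputable def auxG (n : ℕ) (q : ℕ → ℝ) : Polynomial ℝ :=
  ∑ i ∈ Finset.range (n+1), Polynomial.C (q i) * Polynomial.X^(2*i+1)

noncomputable def auxH (n : ℕ) (a : ℕ → ℝ) : Polynomial ℝ :=
  ∑ i ∈ Finset.range (n+1), Polynomial.C (a i) * Polynomial.X^(2*i)

theorem auxG_ode (n : ℕ) (q : ℕ → ℝ)
    (hq : ∀ i < n, (2*i+3)*(2*i+2)*q (i+1) = 2*((n:ℝ)-i) * q i) :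
    (auxG n q).derivative.derivative + Polynomial.X * (auxG n q).derivative
      = Polynomial.C (2*n+1 : ℝ) * auxG n q := by
  have h1 : (auxG n q).derivative
      = ∑ i ∈ Finset.range (n+1), Polynomial.C (q i * (2*i+1)) * Polynomial.X^(2*i) := by
    simp [auxG, mul_assoc]
  have h2 : (auxG n q).derivative.derivative
      = ∑ i ∈ Finset.range n,
        Polynomial.C (q (i+1) * (2*i+3) * (2*i+2)) * Polynomial.X^(2*i+1) := by
    rw [h1, Polynomial.derivative_sum, Finset.sum_range_succ']
    simp only [Polynomial.derivative_C_mul_X_pow]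
    simp only [mul_zero, Nat.cast_zero, map_zero, zero_mul, add_zero]
    refine Finset.sum_congr rfl fun i _ => ?_
    rw [show 2*(i+1)-1 = 2*i+1 by omega]
    congr 2
    push_cast; ring
  rw [h2, h1, auxG, Finset.mul_sum, Finset.mul_sum, Finset.sum_range_succ _ n,
    Finset.sum_range_succ _ n, ← add_assoc, ← Finset.sum_add_distrib]
  congr 1
  · refine Finset.sum_congr rfl fun i hi => ?_
    have h := hq i (Finset.mem_range.mp hi)
    have : q (i+1) * (2*i+3) * (2*i+2) = (2*n+1)*q i - q i * (2*i+1) := by linarith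
    rw [this, map_sub, map_mul (Polynomial.C) (2*n+1:ℝ)]
    ring
  · rw [map_mul]; ring

theorem auxH_ode (n : ℕ) (q a : ℕ → ℝ)
    (ha : ∀ i < n, (2*i+2)*(2*i+1)*a (i+1) = 2*((n:ℝ)+i+1) * a i - 2*(2*i+1)*q i)
    (hn : a n = q n) :
    (auxH n a).derivative.derivative = Polynomial.X * (auxH n a).derivative
      + Polynomial.C (2*n+2 : ℝ) * auxH n a - 2 * (auxG n q).derivative := by
  have h1 : (auxG n q).derivative
      = ∑ i ∈ Finset.range (n+1), Polynomial.C (q i * (2*i+1)) * Polynomial.X^(2*i) := by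
    simp [auxG, mul_assoc]
  have h0 : (auxH n a).derivative
      = ∑ i ∈ Finset.range n, Polynomial.C (a (i+1) * (2*i+2)) * Polynomial.X^(2*i+1) := by
    rw [auxH, Polynomial.derivative_sum, Finset.sum_range_succ']
    simp only [Polynomial.derivative_C_mul_X_pow]
    simp only [mul_zero, Nat.cast_zero, map_zero, zero_mul, add_zero]
    refine Finset.sum_congr rfl fun i _ => ?_
    rw [show 2*(i+1)-1 = 2*i+1 by omega]
    congr 2
    push_cast; ring
  have h0' : Polynomial.X * (auxH n a).derivative
      = ∑ i ∈ Finset.range (n+1), Polynomial.C (a i * (2*i)) * Polynomial.X^(2*i) := by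
    rw [h0, Finset.sum_range_succ', Finset.mul_sum]
    simp only [mul_zero, Nat.cast_zero, map_zero, zero_mul, add_zero]
    refine Finset.sum_congr rfl fun i _ => ?_
    rw [show (2*((i+1:ℕ):ℝ)) = 2*i+2 by push_cast; ring]
    ring
  have h2 : (auxH n a).derivative.derivative
      = ∑ i ∈ Finset.range n,
        Polynomial.C (a (i+1) * (2*i+2) * (2*i+1)) * Polynomial.X^(2*i) := by
    rw [h0]
    simp [mul_assoc]
  rw [h2, h0', h1, auxH, Finset.mul_sum, Finset.mul_sum, ← Finset.sum_add_distrib,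
    ← Finset.sum_sub_distrib, Finset.sum_range_succ _ n]
  have h2C : (2 : Polynomial ℝ) = Polynomial.C 2 := rfl
  rw [h2C, ← add_zero (∑ i ∈ Finset.range n, _)]
  congr 1
  · refine Finset.sum_congr rfl fun i hi => ?_
    have h := ha i (Finset.mem_range.mp hi)
    have : a (i+1) * (2*i+2) * (2*i+1) = a i * (2*i) + (2*n+2) * a i - 2*(q i * (2*i+1)) := by
      linarith
    rw [this, map_sub, map_add, map_mul Polynomial.C (2*n+2:ℝ), map_mul Polynomial.C (2:ℝ)]
    ring
  · rw [← mul_assoc (Polynomial.C (2*n+2:ℝ)), ← mul_assoc (Polynomial.C 2), ← Polynomial.C_mul,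
      ← Polynomial.C_mul, ← add_mul, ← sub_mul, ← Polynomial.C_add, ← Polynomial.C_sub, hn]
    rw [show q n * (2*n) + (2*n+2) * q n - 2*(q n * (2*n+1)) = 0 by ring]
    simp

theorem aux_wronskian (n : ℕ) (G H : Polynomial ℝ)
    (hG : G.derivative.derivative + Polynomial.X * G.derivative = Polynomial.C (2*n+1 : ℝ) * G)
    (hH : H.derivative.derivative = Polynomial.X * H.derivative
      + Polynomial.C (2*n+2 : ℝ) * H - 2 * G.derivative)
    (h0 : G.eval 0 = 0) (h1 : 0 ≤ H.eval 0) (h2 : 0 ≤ G.derivative.eval 0) (x : ℝ) :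
    H.derivative.eval x * G.eval x - H.eval x * G.derivative.eval x
      - x * H.eval x * G.eval x + G.eval x ^ 2 ≤ 0 := by
  set W : Polynomial ℝ := H.derivative * G - H * G.derivative - Polynomial.X * H * G + G^2 with hW
  have hd : W.derivative = 0 := by
    have hG' : G.derivative.derivative
      = Polynomial.C (2*n+1 : ℝ) * G - Polynomial.X * G.derivative := by rw [← hG]; ring
    have hc : Polynomial.C (2*n+2 : ℝ) = Polynomial.C (2*n+1 : ℝ) + 1 := by
      rw [← Polynomial.C_1, ← map_add]; congr 1; ring
    simp only [hW, Polynomial.derivative_add, Polynomial.derivative_sub, Polynomial.derivative_mul,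
      Polynomial.derivative_X, pow_two, hG', hH, hc]
    ring
  have hC := Polynomial.eq_C_of_derivative_eq_zero hd
  have e1 : W.eval x = W.eval 0 := by rw [hC]; simp
  have e2 : W.eval 0 ≤ 0 := by
    simp [hW, h0]; positivity
  rw [← e1] at e2
  simpa [hW] using e2

theorem aux_int (G H : Polynomial ℝ) (hGp : ∀ x : ℝ, 0 < x → 0 < G.eval x)
    (hHp : ∀ x : ℝ, 0 < x → 0 ≤ H.eval x)
    (hw : ∀ x : ℝ, H.derivative.eval x * G.eval x - H.eval x * G.derivative.eval x
      - x * H.eval x * G.eval x + G.eval x ^ 2 ≤ 0) (x : ℝ) (hx : 0 < x) :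
    (∫ t in Set.Ioi x, Real.exp (-t^2/2)) ≤ H.eval x / G.eval x * Real.exp (-x^2/2) := by
  have hint : Integrable (fun t : ℝ => Real.exp (-t^2/2)) := by
    have := integrable_exp_neg_mul_sq (b := 1/2) (by norm_num)
    refine this.congr (Filter.Eventually.of_forall fun t => ?_)
    simp only; congr 1; ring
  have hder : ∀ y : ℝ, 0 < y → HasDerivAt (fun y => -(H.eval y / G.eval y * Real.exp (-y^2/2)))
      (-((H.derivative.eval y * G.eval y - H.eval y * G.derivative.eval y) / G.eval y ^ 2
        * Real.exp (-y^2/2) + H.eval y / G.eval y * (Real.exp (-y^2/2) * (-y)))) y := by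
    intro y hy
    have he : HasDerivAt (fun y : ℝ => Real.exp (-y^2/2)) (Real.exp (-y^2/2) * (-y)) y := by
      apply HasDerivAt.exp
      have := ((hasDerivAt_pow 2 y).fun_neg).div_const 2
      refine this.congr_deriv ?_
      simp
      ring
    exact (((H.hasDerivAt y).fun_div (G.hasDerivAt y) (hGp y hy).ne').fun_mul he).fun_neg
  refine le_of_tendsto (intervalIntegral_tendsto_integral_Ioi x hint.integrableOn Filter.tendsto_id)
    ?_
  filter_upwards [Filter.eventually_ge_atTop x] with y hy
  have key := intervalIntegral.integral_le_sub_of_hasDeriv_right_of_le hy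
    (fun z hz => (hder z (hx.trans_le hz.1)).continuousAt.continuousWithinAt)
    (fun z hz => (hder z (hx.trans hz.1)).hasDerivWithinAt)
    (hint.integrableOn (s := Set.Icc x y)) (fun z hz => by
      have hz0 := hx.trans hz.1
      have hg := hGp z hz0
      have hw' := hw z
      have he := Real.exp_pos (-z^2/2)
      have : -((H.derivative.eval z * G.eval z - H.eval z * G.derivative.eval z) / G.eval z ^ 2
        * Real.exp (-z^2/2) + H.eval z / G.eval z * (Real.exp (-z^2/2) * (-z)))
        - Real.exp (-z^2/2) = -(H.derivative.eval z * G.eval z - H.eval z * G.derivative.eval z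
      - z * H.eval z * G.eval z + G.eval z ^ 2) / G.eval z^2 * Real.exp (-z^2/2) := by
        field_simp; ring
      have h3 : 0 ≤ -(H.derivative.eval z * G.eval z - H.eval z * G.derivative.eval z
      - z * H.eval z * G.eval z + G.eval z ^ 2) / G.eval z^2 * Real.exp (-z^2/2) := by
        apply mul_nonneg (div_nonneg (by linarith) (by positivity)) he.le
      linarith)
  have hy0 := hx.trans_le hy
  have : 0 ≤ H.eval y / G.eval y * Real.exp (-y^2/2) :=
    mul_nonneg (div_nonneg (hHp y hy0) (hGp y hy0).le) (Real.exp_pos _).le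
  simp only [id]
  linarith

theorem stmt5 (n : ℕ) (hn : 1 ≤ n) (x : ℝ) (hx : 0 < x) :
    (∫ t in Set.Ioi x, Real.exp (-t^2/2)) ≤ hp n x / gp n x * Real.exp (-x^2/2) := by
  set q : ℕ → ℝ := fun i => ((2*n+1)! : ℝ) / ((2*(n-i))‼ * (2*i+1)!) with hq
  set a : ℕ → ℝ := fun i => ((n+i)! * (n-i)! : ℝ) / ((2*(n-i))‼ * (2*i)!) *
    (∑ j ∈ Finset.range (n-i+1), ((2*n+1).choose j : ℝ)) with ha
  have hdf : ∀ m : ℕ, 0 < ((m‼ : ℕ) : ℝ) := fun m => by exact_mod_cast Nat.doubleFactorial_pos m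
  have hf : ∀ m : ℕ, 0 < ((m ! : ℕ) : ℝ) := fun m => by exact_mod_cast Nat.factorial_pos m
  have hqp : ∀ i, 0 < q i := fun i => div_pos (hf _) (mul_pos (hdf _) (hf _))
  have hap : ∀ i, 0 ≤ a i := fun i => by positivity
  have eG : ∀ y, (auxG n q).eval y = gp n y := fun y => by
    simp [auxG, gp, Polynomial.eval_finsetSum, hq]
  have eH : ∀ y, (auxH n a).eval y = hp n y := fun y => by
    simp [auxH, hp, Polynomial.eval_finsetSum, ha]
  rw [← eG, ← eH]
  have hHp : ∀ y : ℝ, 0 ≤ y → 0 ≤ (auxH n a).eval y := fun y hy => by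
    simp only [auxH, Polynomial.eval_finsetSum, Polynomial.eval_mul, Polynomial.eval_C,
      Polynomial.eval_pow, Polynomial.eval_X]
    exact Finset.sum_nonneg fun i _ => mul_nonneg (hap i) (by positivity)
  refine aux_int _ _ (fun y hy => ?_) (fun y hy => hHp y hy.le) (aux_wronskian n _ _
    (auxG_ode n q ?_) (auxH_ode n q a ?_ ?_) ?_ (hHp 0 le_rfl) ?_) x hx
  · simp only [auxG, Polynomial.eval_finsetSum, Polynomial.eval_mul, Polynomial.eval_C,
      Polynomial.eval_pow, Polynomial.eval_X]
    exact Finset.sum_pos (fun i _ => mul_pos (hqp i) (by positivity)) ⟨0, by simp⟩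
  · intro i hi
    obtain ⟨k, rfl⟩ : ∃ k, n = i + k + 1 := ⟨n - i - 1, by omega⟩
    have e1 : i + k + 1 - i = k + 1 := by omega
    have e2 : i + k + 1 - (i+1) = k := by omega
    simp only [hq, e1, e2, Nat.doubleFactorial_two_mul, Nat.factorial_succ,
      show 2*(i+1) = 2*i+1+1 by ring]
    have := hf k
    have := hf (2*i)
    push_cast
    field_simp
    ring
  · intro i hi
    obtain ⟨k, rfl⟩ : ∃ k, n = i + k + 1 := ⟨n - i - 1, by omega⟩
    have e1 : i + k + 1 - i = k + 1 := by omega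
    have e2 : i + k + 1 - (i+1) = k := by omega
    have hch : ((2*(i+k+1)+1).choose (k+1) : ℝ)
        = ((2*(i+k+1)+1)! : ℝ) / ((k+1)! * (2*i+k+2)!) := by
      rw [Nat.cast_choose ℝ (by omega), show 2*(i+k+1)+1-(k+1) = 2*i+k+2 by omega]
    simp only [hq, ha, e1, e2, Nat.doubleFactorial_two_mul]
    rw [Finset.sum_range_succ _ (k+1), hch]
    generalize (∑ j ∈ Finset.range (k+1), ((2*(i+k+1)+1).choose j : ℝ)) = S
    generalize (((2*(i+k+1)+1)! : ℕ) : ℝ) = M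
    simp only [show i+k+1+(i+1) = 2*i+k+1+1 by ring, show i+k+1+i = 2*i+k+1 by ring,
      show 2*(i+1) = 2*i+1+1 by ring, show 2*i+k+2 = 2*i+k+1+1 by ring, Nat.factorial_succ]
    have := hf k
    have := hf (2*i)
    have := hf (2*i+k)
    push_cast
    field_simp
    ring
  · have := hf (2*n)
    have := hf (2*n+1)
    simp only [hq, ha, Nat.sub_self, ← two_mul]
    simp
    field_simp
  · simp [auxG, Polynomial.eval_finsetSum]
  · simp only [auxG, Polynomial.derivative_sum, Polynomial.derivative_C_mul_X_pow,
      Polynomial.eval_finsetSum, Polynomial.eval_mul, Polynomial.eval_C,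
      Polynomial.eval_pow, Polynomial.eval_X]
    exact Finset.sum_nonneg fun i _ => mul_nonneg (mul_nonneg (hqp i).le (by positivity)) (by positivity)
end

section
/- For fixed σ ∈ (0,1) and integer n ≥ 1, the function f_n(x) := h_{n-1}(x/σ) + g_{n-1}(x/σ) exp(x²/(2σ²)) ∫_{-∞}^{x/σ} exp(-t²/2) dt - σ^{2n} h_{n-1}(x) + σ^{2n} g_{n-1}(x) exp(x²/2) ∫_x^∞ exp(-t²/2) dt is strictly increasing on (-∞, 0), i.e., f_n'(x) > 0 for all x < 0. -/
open Nat Finset MeasureTheory Real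

noncomputable def PS (N k : ℕ) : ℝ := ∑ j ∈ Finset.range (k+1), (N.choose j : ℝ)

lemma PS_succ (N k : ℕ) : PS N (k+1) = PS N k + (N.choose (k+1) : ℝ) := by
  simp [PS, Finset.sum_range_succ]

lemma PS_pascal (N k : ℕ) : PS (N+1) (k+1) = PS N (k+1) + PS N k := by
  induction k with
  | zero => simp [PS, Finset.sum_range_succ]; ring
  | succ k ih =>
    rw [PS_succ (N+1) (k+1), ih, PS_succ N (k+1), PS_succ N k, Nat.choose_succ_succ]
    push_cast; ring

lemma PS_zero (N : ℕ) : PS N 0 = 1 := by simp [PS]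

lemma ch_rel (N k B : ℕ) (h : N = k + B) : ((k:ℝ)+1) * (N.choose (k+1) : ℝ) = B * N.choose k := by
  have := Nat.choose_succ_right_eq N k
  have h2 : N - k = B := by omega
  rw [h2] at this
  have h3 : ((N.choose (k+1) * (k+1) : ℕ) : ℝ) = ((N.choose k * B : ℕ) : ℝ) := by rw [this]
  push_cast at h3
  linarith

lemma PS_id (i k : ℕ) :
    ((2*i+k+2 : ℝ)) * (2*i+k+1) * PS (2*(i+k)+5) (k+2) =
      2*i*(2*i-1) * PS (2*(i+k)+3) (k+2) + 2*(4*(i+k+1)+3)*(2*i+k+1) * PS (2*(i+k)+3) (k+1)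
      - 8*(i+k+1)*(2*(i+k+1)+1) * PS (2*(i+k)+1) k := by
  cases k with
  | zero =>
    have z1 : ∀ N : ℕ, PS N 1 = 1 + N := by intro N; simp [PS, Finset.sum_range_succ]
    have z2 : ∀ N : ℕ, PS N 2 = 1 + N + N * (N - 1) / 2 := by
      intro N; simp [PS, Finset.sum_range_succ, Nat.cast_choose_two]
    simp only [Nat.zero_add, Nat.add_zero, z1, z2, PS_zero]
    push_cast; ring
  | succ l =>
    have c1 := ch_rel (2*(i+(l+1))+1) l (2*i+l+3) (by omega)
    have c2 := ch_rel (2*(i+(l+1))+1) (l+1) (2*i+l+2) (by omega)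
    have c3 := ch_rel (2*(i+(l+1))+1) (l+2) (2*i+l+1) (by omega)
    generalize hN : 2*(i+(l+1))+1 = N at *
    have e3 : 2*(i+(l+1))+3 = N+2 := by omega
    have e5 : 2*(i+(l+1))+5 = N+4 := by omega
    rw [e3, e5]
    have p0 : ∀ N, PS (N+1) (l+1+2) = PS N (l+1+2) + PS N (l+1+1) := fun N => PS_pascal N _
    have p1 : ∀ N, PS (N+1) (l+1+1) = PS N (l+1+1) + PS N (l+1) := fun N => PS_pascal N _
    have p2 : ∀ N, PS (N+1) (l+1) = PS N (l+1) + PS N l := fun N => PS_pascal N _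
    have q0 : PS N (l+1+2) = PS N (l+1+1) + N.choose (l+1+1+1) := PS_succ N _
    have q1 : PS N (l+1+1) = PS N (l+1) + N.choose (l+1+1) := PS_succ N _
    have q2 : PS N (l+1) = PS N l + N.choose (l+1) := PS_succ N _
    -- P(N+4,k+1) in terms of lower
    have key : PS (N+4) (l+1+2) = 16 * PS N (l+1) + N.choose (l+1+1+1) + 5 * N.choose (l+1+1)
        - 5 * N.choose (l+1) - N.choose l := by
      cases l with
      | zero =>
        have z : ∀ N, PS N 0 = 1 := PS_zero
        simp only [p0, p1, p2, q0, q1, q2]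
        simp only [z, Nat.choose_zero_right, Nat.cast_one]
        ring
      | succ l =>
        have p3 : ∀ N, PS (N+1) (l+1) = PS N (l+1) + PS N l := fun N => PS_pascal N _
        have q3 : PS N (l+1) = PS N l + N.choose (l+1) := PS_succ N _
        simp only [p0, p1, p2, p3, q0, q1, q2, q3]
        ring
    have k1 : PS (N+2) (l+1+2) = 4 * PS N (l+1) + N.choose (l+1+1+1) + 3 * N.choose (l+1+1) := by
      rw [p0, p0, p1, q0, q1]; ring
    have k2 : PS (N+2) (l+1+1) = 4 * PS N (l+1) + N.choose (l+1+1) - N.choose (l+1) := by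
      rw [p1, p1, p2, q1, q2]; ring
    rw [key, k1, k2]
    push_cast at *
    generalize (N.choose (l+1+1+1) : ℝ) = C3 at *
    generalize (N.choose (l+1+1) : ℝ) = C2 at *
    generalize (N.choose (l+1) : ℝ) = C1 at *
    generalize (N.choose l : ℝ) = C0 at *
    generalize (PS N (l+1) : ℝ) = P at *
    linear_combination (2*(2*i+l+2)-(l+2):ℝ) * c3 + (2*i+l+2:ℝ) * c1 - (-5*(2*i+l+3) - (l+1) + 2*(4*(i+l+2)+3) : ℝ) * c2

lemma gen (c : ℕ → ℕ → ℝ)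
    (h0 : ∀ k : ℕ, c 0 (k+2) = (4*k+7) * c 0 (k+1) - (2*k+2)*(2*k+3) * c 0 k)
    (h1 : ∀ m, c (m+2) 0 = c (m+1) 0)
    (h2 : ∀ m : ℕ, c (m+1) 1 = c m 1 + (4*m+7) * c (m+1) 0)
    (h3 : ∀ i k : ℕ, c (i+1) (k+2) = c i (k+2) + (4*(i+1+k)+7) * c (i+1) (k+1)
      - (2*(i+1+k)+2)*(2*(i+1+k)+3) * c (i+1) k) (y : ℝ) (m : ℕ) :
    ∑ i ∈ Finset.range (m+2+1), c i (m+2-i) * y^i =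
      (y + 4*m+7) * ∑ i ∈ Finset.range (m+1+1), c i (m+1-i) * y^i
      - (2*m+2)*(2*m+3) * ∑ i ∈ Finset.range (m+1), c i (m-i) * y^i := by
  obtain ⟨e, he⟩ : ∃ e : ℕ → ℕ → ℝ, ∀ m i, e m i = if i ≤ m then c i (m-i) else 0 := ⟨_, fun _ _ => rfl⟩
  have hs : ∀ m d, ∑ i ∈ Finset.range (m+1), c i (m-i) * y^i = ∑ i ∈ Finset.range (m+1+d), e m i * y^i := by
    intro m d
    rw [Finset.sum_range_add _ (m+1) d]
    have : ∑ x ∈ Finset.range d, e m (m+1+x) * y^(m+1+x) = 0 := by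
      apply Finset.sum_eq_zero; intro x _
      rw [he, if_neg (by omega)]; ring
    rw [this, add_zero]
    apply Finset.sum_congr rfl
    intro i hi
    rw [he, if_pos (by simp at hi; omega)]
  have r0 : e (m+2) 0 = (4*m+7) * e (m+1) 0 - (2*m+2)*(2*m+3) * e m 0 := by
    simp [he, h0]
  have r1 : ∀ i, e (m+2) (i+1) = e (m+1) i + (4*m+7) * e (m+1) (i+1) - (2*m+2)*(2*m+3) * e m (i+1) := by
    intro i
    rcases lt_trichotomy i m with h | h | h
    · obtain ⟨k, rfl⟩ : ∃ k, m = i+1+k := ⟨m-i-1, by omega⟩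
      rw [he, he, he, he, if_pos (by omega), if_pos (by omega), if_pos (by omega), if_pos (by omega)]
      have a1 : i+1+k+2-(i+1) = k+2 := by omega
      have a2 : i+1+k+1-i = k+2 := by omega
      have a3 : i+1+k+1-(i+1) = k+1 := by omega
      have a4 : i+1+k-(i+1) = k := by omega
      rw [a1, a2, a3, a4, h3]; push_cast; ring
    · subst h
      rw [he, he, he, he, if_pos (by omega), if_pos (by omega), if_pos (by omega), if_neg (by omega)]
      have a1 : i+2-(i+1) = 1 := by omega
      have a2 : i+1-i = 1 := by omega
      rw [a1, a2, Nat.sub_self, h2]; ring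
    · rcases Nat.lt_or_ge (m+1) i with h' | h'
      · rw [he, he, he, he, if_neg (by omega), if_neg (by omega), if_neg (by omega), if_neg (by omega)]; ring
      · obtain rfl : i = m+1 := by omega
        rw [he, he, he, he, if_pos (by omega), if_pos (by omega), if_neg (by omega), if_neg (by omega)]
        rw [Nat.sub_self, Nat.sub_self, h1]; ring
  have t1 : ∑ i ∈ Finset.range (m+2), e (m+2) (i+1) * y^(i+1) = y * ∑ i ∈ Finset.range (m+2), e (m+1) i * y^i
      + (4*m+7) * ∑ i ∈ Finset.range (m+2), e (m+1) (i+1) * y^(i+1)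
      - (2*m+2)*(2*m+3) * ∑ i ∈ Finset.range (m+2), e m (i+1) * y^(i+1) := by
    rw [Finset.mul_sum, Finset.mul_sum, Finset.mul_sum, ← Finset.sum_add_distrib, ← Finset.sum_sub_distrib]
    apply Finset.sum_congr rfl
    intro i _
    rw [r1]; ring
  have u1 := Finset.sum_range_succ' (fun i => e (m+1) i * y^i) (m+2)
  have u2 := Finset.sum_range_succ' (fun i => e m i * y^i) (m+2)
  have v1 := hs (m+1) 1
  have v1' := hs (m+1) 0
  have v2 := hs m 2
  have w := hs (m+2) 0
  rw [w, Finset.sum_range_succ', t1, v2]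
  simp only [Nat.add_zero] at *
  have v3 : ∑ i ∈ Finset.range (m+1+1), c i (m+1-i) * y^i = ∑ i ∈ Finset.range (m+2), e (m+1) i * y^i := v1'
  rw [v3] at v1
  rw [v3, r0]
  have v1b : ∑ i ∈ Finset.range (m+2), e (m+1) i * y^i = ∑ i ∈ Finset.range (m+2+1), e (m+1) i * y^i := v1
  have e2 : ∑ i ∈ Finset.range (m+1+2), e m i * y^i = ∑ i ∈ Finset.range (m+2+1), e m i * y^i := rfl
  rw [e2, u2]
  rw [u1] at v1b
  linear_combination (-(4*m+7)) * v1b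

noncomputable def cH (i k : ℕ) : ℝ := ((2*i+k)! : ℝ) / (2^k * (2*i)!) * PS (2*(i+k)+1) k
noncomputable def cG (i k : ℕ) : ℝ := ((2*i+2*k+1)! : ℝ) / (2^k * k ! * (2*i+1)!)

lemma hp_eq (m : ℕ) (x : ℝ) : hp m x = ∑ i ∈ Finset.range (m+1), cH i (m-i) * (x^2)^i := by
  unfold hp
  apply Finset.sum_congr rfl
  intro i hi
  obtain ⟨k, rfl⟩ : ∃ k, m = i + k := ⟨m-i, by simp at hi; omega⟩
  have a : i + k - i = k := by omega
  rw [a, Nat.doubleFactorial_two_mul, cH, PS, ← pow_mul]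
  have b : i + k + i = 2*i+k := by omega
  rw [b]
  have := Nat.factorial_ne_zero k
  have := Nat.factorial_ne_zero (2*i)
  push_cast
  field_simp

lemma gp_eq (m : ℕ) (x : ℝ) : gp m x = x * ∑ i ∈ Finset.range (m+1), cG i (m-i) * (x^2)^i := by
  unfold gp
  rw [Finset.mul_sum]
  apply Finset.sum_congr rfl
  intro i hi
  obtain ⟨k, rfl⟩ : ∃ k, m = i + k := ⟨m-i, by simp at hi; omega⟩
  have a : i + k - i = k := by omega
  rw [a, Nat.doubleFactorial_two_mul, cG, ← pow_mul, mul_add]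
  push_cast
  ring

lemma hp_rec (m : ℕ) (x : ℝ) : hp (m+2) x = (x^2+4*m+7) * hp (m+1) x - (2*m+2)*(2*m+3) * hp m x := by
  rw [hp_eq, hp_eq, hp_eq]
  apply gen
  · intro k
    have h := PS_id 0 k
    simp only [cH, Nat.factorial_succ, Nat.mul_zero, Nat.zero_add, Nat.factorial_zero, mul_add, add_assoc] at *
    norm_num at *
    have : (k:ℝ)+1 ≠ 0 := by positivity
    field_simp
    apply mul_left_cancel₀ this
    linear_combination (2*2^k*2^k:ℝ) * h
  · intro m
    have := Nat.factorial_ne_zero (2*(m+2))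
    have := Nat.factorial_ne_zero (2*(m+1))
    simp only [cH, PS_zero]
    norm_num
    field_simp
  · intro m
    have := Nat.factorial_ne_zero (2*m)
    have z1 : ∀ N : ℕ, PS N 1 = 1 + N := by intro N; simp [PS, Finset.sum_range_succ]
    have e : 2*(m+1) = 2*m+1+1 := by ring
    simp only [cH, PS_zero, z1, e, Nat.factorial_succ]
    push_cast
    have : (2*m+1:ℝ) ≠ 0 := by positivity
    have : (2*m+1+1:ℝ) ≠ 0 := by positivity
    field_simp
    ring
  · intro i k
    have h := PS_id (i+1) k
    have e1 : 2*(i+1)+(k+2) = (2*i+k+2)+1+1 := by ring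
    have e2 : 2*(i+1)+(k+1) = (2*i+k+2)+1 := by ring
    have e3 : 2*(i+1)+k = (2*i+k+2) := by ring
    have e4 : 2*i+(k+2) = (2*i+k+2) := by ring
    have e5 : 2*(i+1) = 2*i+1+1 := by ring
    have f1 : 2*(i+1+(k+2))+1 = 2*(i+1+k)+5 := by ring
    have f2 : 2*(i+(k+2))+1 = 2*(i+1+k)+3 := by ring
    have f3 : 2*(i+1+(k+1))+1 = 2*(i+1+k)+3 := by ring
    simp only [cH, e1, e2, e3, e4, f1, f2, f3]
    rw [e5]
    simp only [Nat.factorial_succ (2*i), Nat.factorial_succ (2*i+1), Nat.factorial_succ (2*i+k+2+1), Nat.factorial_succ (2*i+k+2)]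
    rw [← e5]
    generalize PS (2*(i+1+k)+5) (k+2) = A at *
    generalize PS (2*(i+1+k)+3) (k+2) = B at *
    generalize PS (2*(i+1+k)+3) (k+1) = C at *
    generalize PS (2*(i+1+k)+1) k = D at *
    have := Nat.factorial_ne_zero (2*i)
    have := Nat.factorial_ne_zero (2*i+k+2)
    push_cast at *
    have : (2*i+1:ℝ) ≠ 0 := by positivity
    have : (2*i+1+1:ℝ) ≠ 0 := by positivity
    field_simp
    linear_combination (2*2^k*2^k:ℝ) * h

lemma gp_rec (m : ℕ) (x : ℝ) : gp (m+2) x = (x^2+4*m+7) * gp (m+1) x - (2*m+2)*(2*m+3) * gp m x := by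
  rw [gp_eq, gp_eq, gp_eq]
  rw [gen cG]
  · ring
  · intro k
    have e1 : 2*0+2*(k+2)+1 = 2*k+1+1+1+1+1 := by ring
    have e2 : 2*0+2*(k+1)+1 = 2*k+1+1+1 := by ring
    have e3 : 2*0+2*k+1 = 2*k+1 := by ring
    simp only [cG, e1, e2, e3, Nat.factorial_succ]
    push_cast
    have := Nat.factorial_ne_zero k
    have : (k+1:ℝ) ≠ 0 := by positivity
    have : (k+1+1:ℝ) ≠ 0 := by positivity
    norm_num
    field_simp
    ring
  · intro m
    have := Nat.factorial_ne_zero (2*(m+2)+1)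
    have := Nat.factorial_ne_zero (2*(m+1)+1)
    simp only [cG]
    norm_num
    field_simp
  · intro m
    have := Nat.factorial_ne_zero (2*m)
    have e1 : 2*(m+1)+2*1+1 = 2*m+1+1+1+1+1 := by ring
    have e2 : 2*(m+1)+2*0+1 = 2*m+1+1+1 := by ring
    have e3 : 2*m+2*1+1 = 2*m+1+1+1 := by ring
    have e4 : 2*(m+1)+1 = 2*m+1+1+1 := by ring
    simp only [cG, e1, e2, e3, Nat.factorial_succ]
    push_cast
    have : (2*m+1:ℝ) ≠ 0 := by positivity
    have : (2*m+1+1:ℝ) ≠ 0 := by positivity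
    have : (2*m+1+1+1:ℝ) ≠ 0 := by positivity
    norm_num
    field_simp
    ring
  · intro i k
    have e1 : 2*(i+1)+2*(k+2)+1 = (2*i+2*k+3)+1+1+1+1 := by ring
    have e2 : 2*(i+1)+2*(k+1)+1 = (2*i+2*k+3)+1+1 := by ring
    have e3 : 2*(i+1)+2*k+1 = (2*i+2*k+3) := by ring
    have e4 : 2*i+2*(k+2)+1 = (2*i+2*k+3)+1+1 := by ring
    have e5 : 2*(i+1)+1 = 2*i+1+1+1 := by ring
    simp only [cG, e1, e2, e3, e4]
    generalize hN : 2*i+2*k+3 = N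
    have hN' : (N:ℝ) = 2*i+2*k+3 := by rw [← hN]; push_cast; ring
    simp only [e5, Nat.factorial_succ]
    have := Nat.factorial_ne_zero k
    have := Nat.factorial_ne_zero N
    have := Nat.factorial_ne_zero (2*i)
    push_cast
    rw [hN']
    have : (2*i+1:ℝ) ≠ 0 := by positivity
    have : (2*i+1+1:ℝ) ≠ 0 := by positivity
    have : (2*i+1+1+1:ℝ) ≠ 0 := by positivity
    have : (k+1:ℝ) ≠ 0 := by positivity
    have : (k+1+1:ℝ) ≠ 0 := by positivity
    field_simp
    ring

noncomputable def II (k : ℕ) (x : ℝ) : ℝ := ∫ s in Set.Ioi (0:ℝ), s^k * Real.exp (x*s - s^2/2)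

lemma II_int (k : ℕ) (x : ℝ) :
    IntegrableOn (fun s : ℝ => s^k * Real.exp (x*s - s^2/2)) (Set.Ioi 0) := by
  have h := (integrableOn_rpow_mul_exp_neg_mul_sq (b := 1/4) (by norm_num) (s := (k:ℝ))
    (by have : (0:ℝ) ≤ k := by positivity
        linarith)).const_mul (Real.exp (x^2))
  refine Integrable.mono' h (by fun_prop) ?_
  filter_upwards [ae_restrict_mem measurableSet_Ioi] with s hs
  have hs' : (0:ℝ) < s := hs
  rw [Real.norm_of_nonneg (by positivity), Real.rpow_natCast, mul_left_comm, ← Real.exp_add]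
  gcongr
  nlinarith [sq_nonneg (x - s/2)]

lemma II_pos (k : ℕ) (x : ℝ) : 0 < II k x := by
  unfold II
  rw [setIntegral_pos_iff_support_of_nonneg_ae _ (II_int k x)]
  · have : Set.Ioi (0:ℝ) ⊆ Function.support (fun s : ℝ => s^k * Real.exp (x*s - s^2/2)) := by
      intro s hs
      have hs' : (0:ℝ) < s := hs
      simp only [Function.mem_support]
      positivity
    rw [Set.inter_eq_right.mpr this]
    simp
  · filter_upwards [ae_restrict_mem measurableSet_Ioi] with s hs
    have hs' : (0:ℝ) < s := hs
    simp only [Pi.zero_apply]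
    positivity

lemma II_deriv (k : ℕ) (x : ℝ) : HasDerivAt (II k) (II (k+1) x) x := by
  unfold II
  refine (hasDerivAt_integral_of_dominated_loc_of_deriv_le (s := Metric.ball x 1)
    (F := fun x s => s^k * Real.exp (x*s - s^2/2))
    (F' := fun x s => s^(k+1) * Real.exp (x*s - s^2/2))
    (bound := fun s => s^(k+1) * Real.exp ((x+1)*s - s^2/2))
    (Metric.ball_mem_nhds x one_pos) ?_ (II_int k x) (by fun_prop) ?_ (II_int (k+1) (x+1)) ?_).2
  · exact Filter.Eventually.of_forall fun y => by fun_prop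
  · filter_upwards [ae_restrict_mem measurableSet_Ioi] with s hs y hy
    have hs' : (0:ℝ) < s := hs
    rw [Real.norm_of_nonneg (by positivity)]
    rw [Metric.mem_ball, Real.dist_eq, abs_lt] at hy
    gcongr
    linarith
  · refine Filter.Eventually.of_forall fun s y _ => ?_
    have := (((hasDerivAt_id y).mul_const s).sub_const (s^2/2)).exp.const_mul (s^k)
    refine HasDerivAt.congr_deriv this ?_
    simp only [id]; ring

lemma II_tendsto (k : ℕ) (x : ℝ) :
    Filter.Tendsto (fun s : ℝ => s^k * Real.exp (x*s - s^2/2)) Filter.atTop (nhds 0) := by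
  have h := (Real.tendsto_pow_mul_exp_neg_atTop_nhds_zero k)
  refine squeeze_zero' ?_ ?_ h
  · filter_upwards [Filter.eventually_gt_atTop 0] with s hs
    positivity
  · filter_upwards [Filter.eventually_gt_atTop 0, Filter.eventually_gt_atTop (2*(x+1))] with s hs h2
    gcongr
    nlinarith

lemma hd (x s : ℝ) : HasDerivAt (fun s : ℝ => Real.exp (x*s - s^2/2))
    (Real.exp (x*s - s^2/2) * (x - s)) s := by
  have h : HasDerivAt (fun s : ℝ => x*s - s^2/2) (x - s) s := by
    have := ((hasDerivAt_id s).const_mul x).sub (((hasDerivAt_id s).pow 2).div_const 2)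
    refine HasDerivAt.congr_deriv this ?_
    simp
  exact h.exp

lemma II_one (x : ℝ) : II 1 x = x * II 0 x + 1 := by
  have i0 : IntegrableOn (fun s : ℝ => x * (s^0 * Real.exp (x*s - s^2/2)) - s^1 * Real.exp (x*s - s^2/2)) (Set.Ioi 0) := by
    have := ((II_int 0 x).const_mul x).sub (II_int 1 x)
    exact this
  have h := integral_Ioi_of_hasDerivAt_of_tendsto' (a := 0)
    (f := fun s : ℝ => Real.exp (x*s - s^2/2))
    (f' := fun s => x * (s^0 * Real.exp (x*s - s^2/2)) - s^1 * Real.exp (x*s - s^2/2)) (m := 0)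
    (fun s _ => (hd x s).congr_deriv (by ring))
    i0
    (by simpa using II_tendsto 0 x)
  rw [integral_sub ((II_int 0 x).const_mul x) (II_int 1 x), integral_const_mul] at h
  simp only [II] at *
  norm_num at *
  linarith

lemma II_rec (k : ℕ) (x : ℝ) : II (k+2) x = x * II (k+1) x + (k+1) * II k x := by
  have i1 : IntegrableOn (fun s : ℝ => (k+1) * (s^k * Real.exp (x*s - s^2/2)) + x * (s^(k+1) * Real.exp (x*s - s^2/2))) (Set.Ioi 0) := by
    have := ((II_int k x).const_mul (k+1)).add ((II_int (k+1) x).const_mul x)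
    exact this
  have i2 : IntegrableOn (fun s : ℝ => ((k+1) * (s^k * Real.exp (x*s - s^2/2)) + x * (s^(k+1) * Real.exp (x*s - s^2/2))) - s^(k+2) * Real.exp (x*s - s^2/2)) (Set.Ioi 0) := by
    have := Integrable.sub i1 (II_int (k+2) x)
    exact this
  have h := integral_Ioi_of_hasDerivAt_of_tendsto' (a := 0)
    (f := fun s : ℝ => s^(k+1) * Real.exp (x*s - s^2/2))
    (f' := fun s => ((k+1) * (s^k * Real.exp (x*s - s^2/2)) + x * (s^(k+1) * Real.exp (x*s - s^2/2))) - s^(k+2) * Real.exp (x*s - s^2/2)) (m := 0)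
    (fun s _ => by
      refine HasDerivAt.congr_deriv ((hasDerivAt_pow (k+1) s).mul (hd x s)) ?_
      push_cast
      ring)
    i2
    (II_tendsto (k+1) x)
  rw [integral_sub i1 (II_int (k+2) x), integral_add ((II_int k x).const_mul (k+1)) ((II_int (k+1) x).const_mul x), integral_const_mul, integral_const_mul] at h
  simp only [II] at *
  norm_num at h
  linarith

lemma II_zero' (x : ℝ) : II 0 x = Real.exp (x^2/2) * ∫ t in Set.Ioi (-x), Real.exp (-t^2/2) := by
  have A : MeasurableEmbedding fun s : ℝ => s - x := (Homeomorph.subRight x).measurableEmbedding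
  have h := (measurePreserving_sub_right (volume : Measure ℝ) x).setIntegral_preimage_emb A
    (fun t => Real.exp (-t^2/2)) (Set.Ioi (-x))
  rw [← h, ← integral_const_mul]
  have e : (fun s : ℝ => s - x) ⁻¹' (Set.Ioi (-x)) = Set.Ioi 0 := by
    ext s; simp
  rw [e, II]
  congr 1
  ext s
  rw [← Real.exp_add, pow_zero, one_mul]
  congr 1
  ring

lemma II_zero (x : ℝ) : II 0 x = Real.exp (x^2/2) * ∫ t in Set.Iic x, Real.exp (-t^2/2) := by
  rw [II_zero', ← integral_comp_neg_Iic]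
  simp

lemma II_odd (m : ℕ) (x : ℝ) : II (2*m+1) x = gp m x * II 0 x + hp m x ∧
    II (2*(m+1)+1) x = gp (m+1) x * II 0 x + hp (m+1) x := by
  induction m with
  | zero =>
    have h1 := II_one x
    have h2 := II_rec 0 x
    have h3 := II_rec 1 x
    norm_num [gp, hp, Finset.sum_range_succ, Nat.factorial, Nat.doubleFactorial] at *
    constructor
    · exact h1
    · rw [h3, h2, h1]; ring
  | succ m ih =>
    refine ⟨ih.2, ?_⟩
    have h1 := II_rec (2*m+1) x
    have h2 := II_rec (2*m+1+1) x
    have h3 := II_rec (2*m+1+1+1) x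
    have e1 : 2*(m+1+1)+1 = 2*m+1+1+1+2 := by ring
    have e2 : 2*(m+1)+1 = 2*m+1+1+1 := by ring
    rw [e2] at ih
    rw [e1, gp_rec, hp_rec, h3]
    push_cast at *
    have f1 : II (2*m+1+1+2) x = II (2*m+1+1+1+1) x := rfl
    have f2 : II (2*m+1+2) x = II (2*m+1+1+1) x := rfl
    rw [f1] at *
    rw [f2] at *
    obtain ⟨i1, i2⟩ := ih
    linear_combination x * h2 + (x^2+4*m+7) * i2 - (2*m+2)*(2*m+3) * i1 - (2*m+3) * h1

theorem stmt12 (σ : ℝ) (hσ : σ ∈ Set.Ioo (0:ℝ) 1) (n : ℕ) (hn : 1 ≤ n) :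
    ∀ x : ℝ, x < 0 →
      0 < deriv (fun y : ℝ =>
        hp (n-1) (y/σ) + gp (n-1) (y/σ) * Real.exp (y^2/(2*σ^2))
            * (∫ t in Set.Iic (y/σ), Real.exp (-t^2/2))
          - σ^(2*n) * hp (n-1) y
          + σ^(2*n) * gp (n-1) y * Real.exp (y^2/2)
            * (∫ t in Set.Ioi y, Real.exp (-t^2/2))) x := by
  intro x _
  have hs : 0 < σ := hσ.1
  generalize n - 1 = m
  have key : (fun y : ℝ =>
        hp m (y/σ) + gp m (y/σ) * Real.exp (y^2/(2*σ^2))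
            * (∫ t in Set.Iic (y/σ), Real.exp (-t^2/2))
          - σ^(2*n) * hp m y
          + σ^(2*n) * gp m y * Real.exp (y^2/2)
            * (∫ t in Set.Ioi y, Real.exp (-t^2/2))) =
      fun y => II (2*m+1) (y/σ) - σ^(2*n) * II (2*m+1) (-y) := by
    funext y
    have h1 := (II_odd m (y/σ)).1
    have h2 := (II_odd m (-y)).1
    rw [II_zero] at h1
    rw [II_zero', neg_neg] at h2
    have g1 : gp m (-y) = - gp m y := by rw [gp_eq, gp_eq, neg_sq]; ring
    have g2 : hp m (-y) = hp m y := by rw [hp_eq, hp_eq, neg_sq]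
    have e : (y/σ)^2/2 = y^2/(2*σ^2) := by field_simp
    rw [h1, h2, g1, g2, neg_sq, e]
    ring
  rw [key]
  have d1 : HasDerivAt (fun y => II (2*m+1) (y/σ)) (II (2*m+1+1) (x/σ) * (1/σ)) x :=
    HasDerivAt.comp (h₂ := II (2*m+1)) (h := fun y : ℝ => y/σ) x (II_deriv (2*m+1) (x/σ)) ((hasDerivAt_id x).div_const σ)
  have d2 : HasDerivAt (fun y => II (2*m+1) (-y)) (II (2*m+1+1) (-x) * (-1)) x :=
    (II_deriv (2*m+1) (-x)).comp x (hasDerivAt_id x).neg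
  have d3 : HasDerivAt (fun y => II (2*m+1) (y/σ) - σ^(2*n) * II (2*m+1) (-y)) _ x :=
    d1.sub (d2.const_mul (σ^(2*n)))
  rw [d3.deriv]
  have p1 := II_pos (2*m+1+1) (x/σ)
  have p2 := II_pos (2*m+1+1) (-x)
  have : 0 < II (2*m+1+1) (x/σ) * (1/σ) := by positivity
  have : 0 < σ^(2*n) * II (2*m+1+1) (-x) := by positivity
  linarith
end
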